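/- arXiv:1301.7077 — 2 statements merged into one kernel-verified Lean document; each statement's English description precedes it below -/
import Mathlib

section
/- Let p,q be coprime positive integers. Then for every 1 ≤ m ≤ p+q, every choice of m distinct columns 1 ≤ j_1,…,j_m ≤ p+q, and every n ∈ {0,1}, there exist m distinct rows 1 ≤ i_1,…,i_m ≤ p+q (possibly depending on n) such that (A_n)_{i_k, j_k} = 1 for every k = 1,…,m. -/
open Filter MeasureTheory Set Metric Topology
open scoped ENNReal Classical

noncomputable section

/-- The maps of the iterated function system of the usual Sierpiński gasket. -/
def gasketMap : Fin 3 → ℝ × ℝ → ℝ × ℝ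
  | 0 => fun z => (z.1 / 2, z.2 / 2)
  | 1 => fun z => (z.1 / 2 + 1 / 2, z.2 / 2)
  | 2 => fun z => (z.1 / 2 + 1 / 4, z.2 / 2 + Real.sqrt 3 / 4)

/-- `Δ` is the Sierpiński gasket: the unique nonempty compact set invariant under the IFS. -/
def IsSierpinskiGasket (Δ : Set (ℝ × ℝ)) : Prop :=
  Δ.Nonempty ∧ IsCompact Δ ∧
    Δ = gasketMap 0 '' Δ ∪ gasketMap 1 '' Δ ∪ gasketMap 2 '' Δ

/-- The orthogonal projection onto the line through the origin making angle `θ` with the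
`x`-axis, expressed as the real coordinate along that line. -/
def projAngle (θ : ℝ) (z : ℝ × ℝ) : ℝ := z.1 * Real.cos θ + z.2 * Real.sin θ

/-- The slice `E_{θ,a}`. -/
def sliceSet (Δ : Set (ℝ × ℝ)) (θ a : ℝ) : Set (ℝ × ℝ) :=
  {z ∈ Δ | projAngle θ z = a}

/-- Minimal number of `ε`-balls needed to cover `E` (junk value `0` if there is no
finite cover). -/
def coverNum {X : Type*} [PseudoMetricSpace X] (E : Set X) (ε : ℝ) : ℕ :=
  sInf {n : ℕ | ∃ F : Finset X, F.card = n ∧ E ⊆ ⋃ x ∈ F, Metric.ball x ε}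

/-- Lower box (Minkowski) dimension. -/
def lowerBoxDim {X : Type*} [PseudoMetricSpace X] (E : Set X) : ℝ :=
  liminf (fun ε : ℝ => Real.log (coverNum E ε) / Real.log (1 / ε)) (𝓝[>] 0)

/-- Upper box (Minkowski) dimension. -/
def upperBoxDim {X : Type*} [PseudoMetricSpace X] (E : Set X) : ℝ :=
  limsup (fun ε : ℝ => Real.log (coverNum E ε) / Real.log (1 / ε)) (𝓝[>] 0)

/-- Lower local dimension of a measure at a point. -/
def lowerLocalDim (η : Measure ℝ) (x : ℝ) : ℝ :=
  liminf (fun r : ℝ => Real.log (η (Metric.ball x r)).toReal / Real.log r) (𝓝[>] 0)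

/-- Upper local dimension of a measure at a point. -/
def upperLocalDim (η : Measure ℝ) (x : ℝ) : ℝ :=
  limsup (fun r : ℝ => Real.log (η (Metric.ball x r)).toReal / Real.log r) (𝓝[>] 0)

/-- `ν` is the natural self-similar measure on the Sierpiński gasket `Δ`, i.e. the unique
Borel probability measure with `ν = Σ_{i=0}^2 (1/3) ν ∘ S_i⁻¹` (supported on `Δ`). -/
def IsGasketMeasure (Δ : Set (ℝ × ℝ)) (ν : Measure (ℝ × ℝ)) : Prop :=
  IsProbabilityMeasure ν ∧ ν Δᶜ = 0 ∧
    ν = (3 : ℝ≥0∞)⁻¹ • (ν.map (gasketMap 0) + ν.map (gasketMap 1) + ν.map (gasketMap 2))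

/-- Hausdorff dimension of a measure: `inf {dim_H A : η A = 1}`. -/
def measureDimH (η : Measure ℝ) : ℝ≥0∞ :=
  sInf {d : ℝ≥0∞ | ∃ A : Set ℝ, η A = 1 ∧ dimH A = d}

/-- The matrices `A_0, A_1` of the paper (there rows and columns are indexed by
`1, …, p+q`; here `i : Fin (p+q)` corresponds to the row `i+1`). -/
def gmA (p q : ℕ) (n : ℕ) : Matrix (Fin (p + q)) (Fin (p + q)) ℝ :=
  Matrix.of fun i j =>
    if Int.ModEq ((p : ℤ) + (q : ℤ)) (2 * ((i : ℤ) + 1) + 1 - (n : ℤ)) ((j : ℤ) + 1) ∨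
        (((q : ℤ) + 1 ≤ 2 * ((i : ℤ) + 1) + (n : ℤ) - 1 ∧
            2 * ((i : ℤ) + 1) + (n : ℤ) - 1 ≤ 2 * (q : ℤ) + (p : ℤ)) ∧
          Int.ModEq ((p : ℤ) + (q : ℤ)) (2 * ((i : ℤ) + 1) + 1 - (n : ℤ) - (q : ℤ))
            ((j : ℤ) + 1))
    then 1 else 0

/-- The product `A_{ξ_1} ⋯ A_{ξ_n}` along a word `ξ ∈ {0,1}^n`. -/
def gmProd (p q : ℕ) {n : ℕ} (ξ : Fin n → Fin 2) : Matrix (Fin (p + q)) (Fin (p + q)) ℝ :=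
  (List.ofFn fun m => gmA p q (ξ m : ℕ)).prod

/-- `e ⬝ A_{ξ_1} ⋯ A_{ξ_n} ⬝ e` where `e = (1,…,1)`. -/
def eAe (p q : ℕ) {n : ℕ} (ξ : Fin n → Fin 2) : ℝ :=
  ∑ i : Fin (p + q), ∑ j : Fin (p + q), gmProd p q ξ i j

/-- `e_k ⬝ A_{ξ_1} ⋯ A_{ξ_n} ⬝ e` where `e_k` is the `k`-th standard basis vector. -/
def ekAe (p q : ℕ) {n : ℕ} (k : Fin (p + q)) (ξ : Fin n → Fin 2) : ℝ :=
  ∑ j : Fin (p + q), gmProd p q ξ k j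

/-- The maps of the IFS of the right-angle Sierpiński gasket. -/
def rgasketMap : Fin 3 → ℝ × ℝ → ℝ × ℝ
  | 0 => fun z => (z.1 / 2, z.2 / 2)
  | 1 => fun z => (z.1 / 2 + 1 / 2, z.2 / 2)
  | 2 => fun z => (z.1 / 2, z.2 / 2 + 1 / 2)

/-- `Λ` is the right-angle Sierpiński gasket. -/
def IsRightGasket (Λ : Set (ℝ × ℝ)) : Prop :=
  Λ.Nonempty ∧ IsCompact Λ ∧
    Λ = rgasketMap 0 '' Λ ∪ rgasketMap 1 '' Λ ∪ rgasketMap 2 '' Λ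

/-- The slice of the right-angle gasket by the line `y = a + (p/q) x`. -/
def rslice (Λ : Set (ℝ × ℝ)) (p q : ℕ) (a : ℝ) : Set (ℝ × ℝ) :=
  {z ∈ Λ | z.2 = a + ((p : ℝ) / (q : ℝ)) * z.1}

/-- The cylinder set `Δ_{i_1 ⋯ i_n} = S_{i_1} ∘ ⋯ ∘ S_{i_n}(Δ)`. -/
def cylSet (Δ : Set (ℝ × ℝ)) {n : ℕ} (w : Fin n → Fin 3) : Set (ℝ × ℝ) :=
  (List.ofFn fun m => gasketMap (w m)).foldr (fun f E => f '' E) Δ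


/-- Every integer is congruent modulo `N > 0` to exactly one of `1, …, N`; here, existence. -/
theorem exists_fin_modEq_add_one {N : ℕ} (hN : 0 < N) (a : ℤ) :
    ∃ j : Fin N, a ≡ (j : ℤ) + 1 [ZMOD N] := by
  have h0 : 0 ≤ (a - 1) % N := Int.emod_nonneg _ (by omega)
  have h1 : (a - 1) % N < N := Int.emod_lt_of_pos _ (by omega)
  refine ⟨⟨((a - 1) % N).toNat, by omega⟩, ?_⟩
  have h2 := ((Int.mod_modEq (a - 1) N).add_right 1).symm
  simpa [Int.toNat_of_nonneg h0] using h2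

/-- Two indices below `N` whose difference is a multiple `M * k` with `N ≤ 2 * M` satisfy
`|k| ≤ 1`. -/
theorem abs_le_one_of_sub_eq_mul {N M a b k : ℤ} (hM : N ≤ 2 * M) (ha : 0 ≤ a) (haN : a < N)
    (hb : 0 ≤ b) (hbN : b < N) (h : a - b = M * k) : -1 ≤ k ∧ k ≤ 1 := by
  constructor
  · by_contra! hk
    nlinarith
  · by_contra! hk
    nlinarith

/-- A choice of one unit entry in each row of `gmA p q n`, given by integer representatives of
the column residues, such that different rows use different columns. -/
theorem exists_gmA_transversal {p q n : ℕ} (hq : 0 < q) (hpq : Nat.Coprime p q) (hn : n ≤ 1) :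
    ∃ g : Fin (p + q) → ℤ,
      (∀ i (j : Fin (p + q)), g i ≡ (j : ℤ) + 1 [ZMOD ((p + q : ℕ) : ℤ)] → gmA p q n i j = 1) ∧
      ∀ i i', g i ≡ g i' [ZMOD ((p + q : ℕ) : ℤ)] → i = i' := by
  rcases Nat.even_or_odd' (p + q) with ⟨M, hM | hM⟩
  · have hodd : q % 2 = 1 := by
      by_contra h
      have h2 : 2 ∣ Nat.gcd p q := Nat.dvd_gcd (by omega) (by omega)
      rw [hpq.gcd_eq_one] at h2
      omega
    refine ⟨fun i => 2 * ((i : ℤ) + 1) + 1 - n -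
      if (q : ℤ) + 1 ≤ 2 * ((i : ℤ) + 1) + n - 1 ∧
        2 * ((i : ℤ) + 1) + n - 1 ≤ 2 * (q : ℤ) + p then (q : ℤ) else 0, ?_, ?_⟩
    · intro i j h
      rw [Nat.cast_add] at h
      simp only [gmA, Matrix.of_apply]
      refine if_pos ?_
      dsimp only at h
      split_ifs at h with hc
      · exact Or.inr ⟨hc, h⟩
      · exact Or.inl (by simpa using h)
    · intro i i' h
      obtain ⟨k, hk⟩ := h.symm.dvd
      rw [show ((p + q : ℕ) : ℤ) = _ from congrArg Nat.cast hM] at hk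
      push_cast at hk
      rw [mul_assoc] at hk
      have hi := i.isLt
      have hi' := i'.isLt
      have key : ((i : ℕ) : ℤ) - (i' : ℕ) = M * k := by
        split_ifs at hk <;> omega
      obtain ⟨hk1, hk2⟩ := abs_le_one_of_sub_eq_mul (N := (p : ℤ) + q) (by omega) (by omega)
        (by omega) (by omega) (by omega) key
      ext
      interval_cases k <;> split_ifs at hk <;> omega
  · refine ⟨fun i => 2 * ((i : ℤ) + 1) + 1 - n, ?_, ?_⟩
    · intro i j h
      rw [Nat.cast_add] at h
      simp only [gmA, Matrix.of_apply]
      exact if_pos (Or.inl h)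
    · intro i i' h
      obtain ⟨k, hk⟩ := h.symm.dvd
      have hi := i.isLt
      have hi' := i'.isLt
      rw [show ((p + q : ℕ) : ℤ) = _ from congrArg Nat.cast hM] at hk
      push_cast at hk
      have hs : (2 * (M : ℤ) + 1) * k = 2 * (M * k) + k := by ring
      rw [hs] at hk
      obtain ⟨l, rfl⟩ : ∃ l, k = 2 * l := ⟨k / 2, by omega⟩
      have key : ((i : ℕ) : ℤ) - (i' : ℕ) = (2 * M + 1) * l := by linarith
      obtain ⟨hl1, hl2⟩ := abs_le_one_of_sub_eq_mul (N := (p : ℤ) + q) (by omega) (by omega)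
        (by omega) (by omega) (by omega) key
      ext
      interval_cases l <;> omega

/-- **Lemma.** For coprime positive integers `p, q`, every `1 ≤ m ≤ p+q`, every choice of
`m` distinct columns and every `n ∈ {0,1}`, there exist `m` distinct rows meeting those
columns in entries equal to `1`. -/
theorem gmA_distinct_rows_for_distinct_columns
    (p q : ℕ) (hp : 0 < p) (hq : 0 < q) (hpq : Nat.Coprime p q)
    (m : ℕ) (hm : 1 ≤ m) (hm' : m ≤ p + q)
    (J : Fin m → Fin (p + q)) (hJ : Function.Injective J)
    (n : ℕ) (hn : n ≤ 1) :
    ∃ I : Fin m → Fin (p + q), Function.Injective I ∧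
      ∀ k : Fin m, gmA p q n (I k) (J k) = 1 := by
  obtain ⟨g, hg, hginj⟩ := exists_gmA_transversal hq hpq hn
  choose f hf using fun i => exists_fin_modEq_add_one (N := p + q) (by omega) (g i)
  have hfinj : Function.Injective f := by
    intro i i' h
    refine hginj i i' ((hf i).trans ?_)
    rw [h]
    exact (hf i').symm
  obtain ⟨r, hr⟩ := (Finite.injective_iff_surjective.mp hfinj).hasRightInverse
  refine ⟨r ∘ J, hr.injective.comp hJ, fun k => hg _ _ ?_⟩
  have h := hf (r (J k))
  rwa [hr (J k)] at h

end
end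

section
/- Let p,q be coprime positive integers and let P(t) be the associated pressure function. Then P is differentiable on (0,∞) and lim_{t→0+} P'(t) = α(θ)·log 2, where α(θ) = (1/log 2)·lim_{n→∞} (1/n) Σ_{(ξ_1,…,ξ_n)∈{0,1}^n} 2^{-n} log(e·A_{ξ_1}⋯A_{ξ_n}·e). -/
open Filter MeasureTheory Set Metric Topology
open scoped ENNReal Classical

noncomputable section

theorem Subadditive.mul_le_of_tendsto_div {u : ℕ → ℝ} (hu : Subadditive u) {l : ℝ}
    (hl : Tendsto (fun n : ℕ => u n / n) atTop (𝓝 l)) (n : ℕ) : n * l ≤ u n := by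
  rcases eq_or_ne n 0 with rfl | hn
  · have := hu 0 0
    simp only [add_zero] at this
    simp only [Nat.cast_zero, zero_mul]
    linarith
  · have hb := hl.bddBelow_range
    have := hu.lim_le_div hb hn
    rw [tendsto_nhds_unique (hu.tendsto_lim hb) hl,
      le_div_iff₀ (by exact_mod_cast Nat.pos_of_ne_zero hn)] at this
    linarith

section WordSums

variable {ι : Type*} [Fintype ι]

/-- The finite set of words of length `n` over the alphabet `ι`. -/
def wordsOfLength (ι : Type*) [Fintype ι] (n : ℕ) : Finset (List ι) :=
  (Finset.univ : Finset (Fin n → ι)).map ⟨List.ofFn, List.ofFn_injective⟩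

theorem mem_wordsOfLength {n : ℕ} {u : List ι} : u ∈ wordsOfLength ι n ↔ u.length = n := by
  constructor
  · intro h
    obtain ⟨ξ, -, rfl⟩ := Finset.mem_map.1 h
    exact List.length_ofFn
  · rintro rfl
    exact Finset.mem_map.2 ⟨u.get, Finset.mem_univ _, List.ofFn_get u⟩

theorem card_wordsOfLength (n : ℕ) : (wordsOfLength ι n).card = Fintype.card ι ^ n := by
  simp [wordsOfLength]

theorem sum_wordsOfLength (n : ℕ) (F : List ι → ℝ) :
    ∑ u ∈ wordsOfLength ι n, F u = ∑ ξ : Fin n → ι, F (List.ofFn ξ) := by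
  simp [wordsOfLength]

theorem sum_wordsOfLength_zero (F : List ι → ℝ) : ∑ u ∈ wordsOfLength ι 0, F u = F [] := by
  simp [sum_wordsOfLength]

theorem sum_wordsOfLength_add (m n : ℕ) (F : List ι → ℝ) :
    ∑ u ∈ wordsOfLength ι (m + n), F u =
      ∑ u ∈ wordsOfLength ι m, ∑ v ∈ wordsOfLength ι n, F (u ++ v) := by
  rw [← Finset.sum_product']
  refine Finset.sum_nbij' (fun u => (u.take m, u.drop m)) (fun x => x.1 ++ x.2) ?_ ?_ ?_ ?_ ?_
  · intro u hu
    rw [mem_wordsOfLength] at hu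
    simp [mem_wordsOfLength, hu]
  · intro x hx
    rw [Finset.mem_product, mem_wordsOfLength, mem_wordsOfLength] at hx
    simp [mem_wordsOfLength, hx]
  · simp
  · intro x hx
    rw [Finset.mem_product, mem_wordsOfLength, mem_wordsOfLength] at hx
    ext1
    · simp [← hx.1]
    · simp [← hx.1]
  · simp

end WordSums

section Pressure

variable {ι : Type*} [Fintype ι]

/-- A weight on words, bounded below by `1`, that is submultiplicative, and supermultiplicative
up to a constant after insertion of a suitable word of fixed length. -/
structure IsQuasiMultiplicative (f : List ι → ℝ) : Prop where
  one_le : ∀ u, 1 ≤ f u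
  append_le : ∀ u v, f (u ++ v) ≤ f u * f v
  exists_le_append : ∃ (r : ℕ) (c : ℝ), 0 < c ∧
    ∀ u v, ∃ w ∈ wordsOfLength ι r, c * (f u * f v) ≤ f (u ++ (w ++ v))

/-- The partition function of a weight on words. -/
def partitionSum (f : List ι → ℝ) (n : ℕ) (t : ℝ) : ℝ :=
  ∑ u ∈ wordsOfLength ι n, f u ^ t

/-- The partition function over the words with a given prefix. -/
def prefixSum (f : List ι → ℝ) (t : ℝ) (n : ℕ) (u : List ι) : ℝ :=
  ∑ v ∈ wordsOfLength ι n, f (u ++ v) ^ t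

/-- `P` is the pressure function of the weight `f`. -/
def IsPressure (f : List ι → ℝ) (P : ℝ → ℝ) : Prop :=
  ∀ t, Tendsto (fun n : ℕ => Real.log (partitionSum f n t) / n) atTop (𝓝 (P t))

namespace IsQuasiMultiplicative

variable {f : List ι → ℝ} {P : ℝ → ℝ}

theorem pos (hf : IsQuasiMultiplicative f) (u : List ι) : 0 < f u :=
  zero_lt_one.trans_le (hf.one_le u)

theorem prefixSum_add (f : List ι → ℝ) (t : ℝ) (m n : ℕ) (u : List ι) :
    prefixSum f t (m + n) u = ∑ v ∈ wordsOfLength ι m, prefixSum f t n (u ++ v) := by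
  simp [prefixSum, sum_wordsOfLength_add]

theorem partitionSum_add (f : List ι → ℝ) (t : ℝ) (m n : ℕ) :
    partitionSum f (m + n) t = ∑ u ∈ wordsOfLength ι m, prefixSum f t n u := by
  simp [prefixSum, partitionSum, sum_wordsOfLength_add]

theorem rpow_append_le (hf : IsQuasiMultiplicative f) {t : ℝ} (ht : 0 ≤ t) (u v : List ι) :
    f (u ++ v) ^ t ≤ f u ^ t * f v ^ t := by
  rw [← Real.mul_rpow (hf.pos u).le (hf.pos v).le]
  exact Real.rpow_le_rpow (hf.pos _).le (hf.append_le u v) ht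

theorem prefixSum_le (hf : IsQuasiMultiplicative f) {t : ℝ} (ht : 0 ≤ t) (n : ℕ) (u : List ι) :
    prefixSum f t n u ≤ f u ^ t * partitionSum f n t := by
  rw [partitionSum, Finset.mul_sum]
  exact Finset.sum_le_sum fun v _ => hf.rpow_append_le ht u v

theorem partitionSum_add_le (hf : IsQuasiMultiplicative f) {t : ℝ} (ht : 0 ≤ t) (m n : ℕ) :
    partitionSum f (m + n) t ≤ partitionSum f m t * partitionSum f n t := by
  rw [partitionSum_add, partitionSum, Finset.sum_mul]
  exact Finset.sum_le_sum fun u _ => hf.prefixSum_le ht n u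

theorem partitionSum_pos [Nonempty ι] (hf : IsQuasiMultiplicative f) (n : ℕ) (t : ℝ) :
    0 < partitionSum f n t := by
  refine Finset.sum_pos (fun u _ => Real.rpow_pos_of_pos (hf.pos u) t) ?_
  rw [← Finset.card_pos, card_wordsOfLength]
  positivity

theorem exists_le_sum_rpow (hf : IsQuasiMultiplicative f) {t : ℝ} (ht : 0 ≤ t) :
    ∃ (r : ℕ) (c : ℝ), 0 < c ∧ ∀ u v,
      c * (f u ^ t * f v ^ t) ≤ ∑ w ∈ wordsOfLength ι r, f (u ++ (w ++ v)) ^ t := by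
  obtain ⟨r, c, hc, h⟩ := hf.exists_le_append
  refine ⟨r, c ^ t, by positivity, fun u v => ?_⟩
  obtain ⟨w, hw, hle⟩ := h u v
  have hu := hf.pos u
  have hv := hf.pos v
  calc c ^ t * (f u ^ t * f v ^ t) = (c * (f u * f v)) ^ t := by
        rw [Real.mul_rpow hc.le (by positivity), Real.mul_rpow hu.le hv.le]
    _ ≤ f (u ++ (w ++ v)) ^ t := Real.rpow_le_rpow (by positivity) hle ht
    _ ≤ _ := Finset.single_le_sum (f := fun w => f (u ++ (w ++ v)) ^ t)
        (fun w _ => Real.rpow_nonneg (hf.pos _).le t) hw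

theorem exists_le_prefixSum [Nonempty ι] (hf : IsQuasiMultiplicative f) {t : ℝ} (ht : 0 ≤ t) :
    ∃ κ : ℝ, 0 < κ ∧ ∀ n u, κ * (f u ^ t * partitionSum f n t) ≤ prefixSum f t n u := by
  obtain ⟨r, c, hc, h⟩ := hf.exists_le_sum_rpow ht
  have hS := hf.partitionSum_pos r t
  refine ⟨c / partitionSum f r t, by positivity, fun n u => ?_⟩
  rw [div_mul_eq_mul_div, div_le_iff₀ hS]
  calc c * (f u ^ t * partitionSum f n t)
      = ∑ v ∈ wordsOfLength ι n, c * (f u ^ t * f v ^ t) := by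
        simp only [partitionSum, Finset.mul_sum]
    _ ≤ ∑ v ∈ wordsOfLength ι n, ∑ w ∈ wordsOfLength ι r, f (u ++ (w ++ v)) ^ t :=
        Finset.sum_le_sum fun v _ => h u v
    _ = prefixSum f t (n + r) u := by
        rw [Finset.sum_comm, add_comm, prefixSum, sum_wordsOfLength_add]
    _ ≤ ∑ v ∈ wordsOfLength ι n, f (u ++ v) ^ t * partitionSum f r t := by
        rw [prefixSum_add]
        exact Finset.sum_le_sum fun v _ => hf.prefixSum_le ht r _
    _ = prefixSum f t n u * partitionSum f r t := by rw [prefixSum, Finset.sum_mul]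

theorem exp_le_partitionSum [Nonempty ι] (hf : IsQuasiMultiplicative f) (hP : IsPressure f P)
    {t : ℝ} (ht : 0 ≤ t) (n : ℕ) : Real.exp (n * P t) ≤ partitionSum f n t := by
  have hsub : Subadditive fun n => Real.log (partitionSum f n t) := fun m n => by
    rw [← Real.log_mul (hf.partitionSum_pos m t).ne' (hf.partitionSum_pos n t).ne']
    exact Real.log_le_log (hf.partitionSum_pos _ t) (hf.partitionSum_add_le ht m n)
  rw [← Real.le_log_iff_exp_le (hf.partitionSum_pos n t)]
  exact hsub.mul_le_of_tendsto_div (hP t) n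

theorem exists_partitionSum_le [Nonempty ι] (hf : IsQuasiMultiplicative f) (hP : IsPressure f P)
    {t : ℝ} (ht : 0 ≤ t) :
    ∃ C : ℝ, 0 < C ∧ ∀ n : ℕ, partitionSum f n t ≤ C * Real.exp (n * P t) := by
  obtain ⟨κ, hκ, h⟩ := hf.exists_le_prefixSum ht
  have hsuper : ∀ m n, κ * (partitionSum f m t * partitionSum f n t) ≤
      partitionSum f (m + n) t := fun m n => by
    calc κ * (partitionSum f m t * partitionSum f n t)
        = ∑ u ∈ wordsOfLength ι m, κ * (f u ^ t * partitionSum f n t) := by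
          rw [← Finset.mul_sum, ← Finset.sum_mul, partitionSum]
      _ ≤ _ := by
          rw [partitionSum_add]
          exact Finset.sum_le_sum fun u _ => h n u
  have hsub : Subadditive fun n => -Real.log (κ * partitionSum f n t) := fun m n => by
    have hm := hf.partitionSum_pos m t
    have hn := hf.partitionSum_pos n t
    simp only
    rw [← neg_add, neg_le_neg_iff, ← Real.log_mul (by positivity) (by positivity)]
    refine Real.log_le_log (by positivity) ?_
    calc _ = κ * (κ * (partitionSum f m t * partitionSum f n t)) := by ring
      _ ≤ _ := by gcongr; exact hsuper m n
  have hlim : Tendsto (fun n : ℕ => -Real.log (κ * partitionSum f n t) / n) atTop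
      (𝓝 (-P t)) := by
    have h1 := ((tendsto_const_div_atTop_nhds_zero_nat (Real.log κ)).add (hP t)).neg
    rw [zero_add] at h1
    refine h1.congr fun n => ?_
    rw [Real.log_mul hκ.ne' (hf.partitionSum_pos n t).ne']
    ring
  refine ⟨κ⁻¹, by positivity, fun n => ?_⟩
  have hn := hf.partitionSum_pos n t
  have h2 := hsub.mul_le_of_tendsto_div hlim n
  rw [le_inv_mul_iff₀ hκ, ← Real.log_le_iff_le_exp (by positivity)]
  linarith

theorem exists_le_exp (hf : IsQuasiMultiplicative f) :
    ∃ M : ℝ, 0 ≤ M ∧ ∀ u, f u ≤ Real.exp (M * (u.length + 1)) := by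
  let D : ℝ := f [] + ∑ i, f [i]
  have hi : ∀ i, f [i] ≤ D := fun i =>
    (Finset.single_le_sum (f := fun i => f [i]) (fun i _ => (hf.pos _).le)
      (Finset.mem_univ i)).trans (le_add_of_nonneg_left (hf.pos _).le)
  have h0 : f [] ≤ D := le_add_of_nonneg_right (Finset.sum_nonneg fun i _ => (hf.pos _).le)
  have hD : 1 ≤ D := (hf.one_le _).trans h0
  have hpow : ∀ u : List ι, f u ≤ D ^ (u.length + 1) := fun u => by
    induction u with
    | nil => simpa using h0
    | cons i u ih =>
      calc f (i :: u) ≤ f [i] * f u := hf.append_le [i] u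
        _ ≤ D * D ^ (u.length + 1) := mul_le_mul (hi i) ih (hf.pos u).le (by linarith)
        _ = _ := by rw [List.length_cons]; ring
  refine ⟨Real.log D, Real.log_nonneg hD, fun u => (hpow u).trans_eq ?_⟩
  rw [mul_comm, ← Nat.cast_succ, Real.exp_nat_mul, Real.exp_log (by linarith)]

theorem exists_light_mass [Nonempty ι] (hf : IsQuasiMultiplicative f) (hP : IsPressure f P)
    {t a : ℝ} (ht : 0 < t) (ha : ∀ h, 0 < h → h ≤ t → P t - a * h ≤ P (t - h))
    {ε : ℝ} (hε : 0 < ε) :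
    ∃ δ : ℝ, 0 < δ ∧ ∀ᶠ m : ℕ in atTop, δ * Real.exp (m * P t) ≤
      ∑ v ∈ wordsOfLength ι m with f v ≤ Real.exp ((a + ε) * m), f v ^ t := by
  obtain ⟨C, hC, hS⟩ := hf.exists_partitionSum_le hP ht.le
  obtain ⟨l, hl0, hl⟩ : ∃ l : ℝ, 0 < l ∧ C * Real.exp (-(l * ε)) ≤ 1 / 2 := by
    have h1 : Tendsto (fun l : ℝ => C * Real.exp (-(l * ε))) atTop (𝓝 (C * 0)) :=
      (Real.tendsto_exp_neg_atTop_nhds_zero.comp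
        (tendsto_id.atTop_mul_const hε)).const_mul C
    rw [mul_zero] at h1
    exact ((eventually_gt_atTop 0).and (h1.eventually_le_const (by norm_num))).exists
  refine ⟨Real.exp (-(l * a)) / 2, by positivity, ?_⟩
  filter_upwards [eventually_gt_atTop ⌈l / t⌉₊] with m hm
  have hm0 : (0 : ℝ) < m := by exact_mod_cast (Nat.zero_le _).trans_lt hm
  have hlt : l / m ≤ t := by
    rw [div_le_iff₀ hm0, mul_comm, ← div_le_iff₀ ht]
    exact (Nat.lt_of_ceil_lt hm).le
  have hlm : 0 < l / m := by positivity
  have hlow : Real.exp (m * P t) * Real.exp (-(l * a)) ≤ partitionSum f m (t - l / m) := by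
    refine le_trans ?_ (hf.exp_le_partitionSum hP (sub_nonneg.2 hlt) m)
    rw [← Real.exp_add, Real.exp_le_exp]
    have := mul_le_mul_of_nonneg_left (ha _ hlm hlt) hm0.le
    have e : (m : ℝ) * (P t - a * (l / m)) = m * P t + -(l * a) := by field_simp; ring
    linarith
  have hup : partitionSum f m (t - l / m) ≤
      (∑ v ∈ wordsOfLength ι m with f v ≤ Real.exp ((a + ε) * m), f v ^ t) +
        Real.exp (-(l * (a + ε))) * partitionSum f m t := by
    rw [partitionSum, ← Finset.sum_filter_add_sum_filter_not _
      (fun v => f v ≤ Real.exp ((a + ε) * m))]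
    refine add_le_add (Finset.sum_le_sum fun v _ =>
      Real.rpow_le_rpow_of_exponent_le (hf.one_le v) (by linarith)) ?_
    rw [partitionSum, Finset.mul_sum]
    refine (Finset.sum_le_sum fun v hv => ?_).trans (Finset.sum_le_sum_of_subset_of_nonneg
      (Finset.filter_subset _ _) fun v _ _ => by have := hf.pos v; positivity)
    have hv' : Real.exp ((a + ε) * m) ≤ f v := (not_le.1 (Finset.mem_filter.1 hv).2).le
    rw [sub_eq_neg_add, Real.rpow_add (hf.pos v)]
    refine mul_le_mul_of_nonneg_right ?_ (Real.rpow_nonneg (hf.pos v).le t)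
    calc f v ^ (-(l / m)) ≤ Real.exp ((a + ε) * m) ^ (-(l / m)) :=
          Real.rpow_le_rpow_of_nonpos (Real.exp_pos _) hv' (by linarith)
      _ = Real.exp (-(l * (a + ε))) := by
          rw [← Real.exp_mul]; congr 1; field_simp
  have hrest : Real.exp (-(l * (a + ε))) * partitionSum f m t ≤
      1 / 2 * (Real.exp (m * P t) * Real.exp (-(l * a))) := by
    calc _ ≤ Real.exp (-(l * (a + ε))) * (C * Real.exp (m * P t)) := by gcongr; exact hS m
      _ = C * Real.exp (-(l * ε)) * (Real.exp (m * P t) * Real.exp (-(l * a))) := by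
          rw [mul_add, neg_add, Real.exp_add]; ring
      _ ≤ _ := by gcongr
  linarith

theorem eventually_heavy_mass_le [Nonempty ι] (hf : IsQuasiMultiplicative f)
    (hP : IsPressure f P) {t b : ℝ} (ht : 0 < t)
    (hb : ∀ ε, 0 < ε → ∃ τ, 0 < τ ∧ P (t + τ) ≤ P t + (b + ε) * τ)
    {ε κ : ℝ} (hε : 0 < ε) (hκ : 0 < κ) :
    ∀ᶠ m : ℕ in atTop,
      ∑ v ∈ wordsOfLength ι m with ¬ f v ≤ Real.exp ((b + ε) * m), f v ^ t ≤
        κ * Real.exp (m * P t) := by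
  obtain ⟨τ, hτ, hPτ⟩ := hb (ε / 2) (by positivity)
  obtain ⟨C, hC, hS⟩ := hf.exists_partitionSum_le hP (t := t + τ) (by positivity)
  have h1 : Tendsto (fun m : ℕ => C * Real.exp (-(m * (τ * ε / 2)))) atTop (𝓝 (C * 0)) :=
    (Real.tendsto_exp_neg_atTop_nhds_zero.comp
      (tendsto_natCast_atTop_atTop.atTop_mul_const (by positivity))).const_mul C
  rw [mul_zero] at h1
  filter_upwards [h1.eventually_le_const hκ] with m hm
  calc ∑ v ∈ wordsOfLength ι m with ¬ f v ≤ Real.exp ((b + ε) * m), f v ^ t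
      ≤ ∑ v ∈ wordsOfLength ι m, Real.exp (-((b + ε) * m * τ)) * f v ^ (t + τ) := by
        refine (Finset.sum_le_sum fun v hv => ?_).trans (Finset.sum_le_sum_of_subset_of_nonneg
          (Finset.filter_subset _ _) fun v _ _ => by have := hf.pos v; positivity)
        have hv' : Real.exp ((b + ε) * m) ≤ f v := (not_le.1 (Finset.mem_filter.1 hv).2).le
        have h2 := Real.rpow_le_rpow (Real.exp_pos _).le hv' hτ.le
        rw [← Real.exp_mul] at h2
        rw [Real.rpow_add (hf.pos v), Real.exp_neg, inv_mul_eq_div, le_div_iff₀ (Real.exp_pos _)]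
        exact mul_le_mul_of_nonneg_left h2 (Real.rpow_nonneg (hf.pos v).le t)
    _ = Real.exp (-((b + ε) * m * τ)) * partitionSum f m (t + τ) := by
        rw [partitionSum, Finset.mul_sum]
    _ ≤ Real.exp (-((b + ε) * m * τ)) * (C * Real.exp (m * (P t + (b + ε / 2) * τ))) := by
        gcongr
        exact (hS m).trans (by gcongr)
    _ = C * Real.exp (-(m * (τ * ε / 2))) * Real.exp (m * P t) := by
        rw [mul_left_comm, ← Real.exp_add, mul_assoc C, ← Real.exp_add]
        congr 2; ring
    _ ≤ κ * Real.exp (m * P t) := by gcongr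

theorem exists_light_prefixSum [Nonempty ι] (hf : IsQuasiMultiplicative f)
    (hP : IsPressure f P) {t a : ℝ} (ht : 0 < t)
    (ha : ∀ h, 0 < h → h ≤ t → P t - a * h ≤ P (t - h)) {ε : ℝ} (hε : 0 < ε) :
    ∃ δ : ℝ, 0 < δ ∧ ∀ᶠ m : ℕ in atTop, ∀ n u, δ * prefixSum f t (m + n) u ≤
      ∑ v ∈ wordsOfLength ι m with f v ≤ Real.exp ((a + ε) * m), prefixSum f t n (u ++ v) := by
  obtain ⟨r, c, hc, hr⟩ := hf.exists_le_sum_rpow ht.le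
  obtain ⟨κ, hκ, hT⟩ := hf.exists_le_prefixSum ht.le
  obtain ⟨C, hC, hS⟩ := hf.exists_partitionSum_le hP ht.le
  obtain ⟨M, hM, hfM⟩ := hf.exists_le_exp
  obtain ⟨δ, hδ, hmass⟩ := hf.exists_light_mass hP ht ha (half_pos hε)
  refine ⟨κ * c * δ * Real.exp (-(r * P t)) / C, by positivity, ?_⟩
  obtain ⟨m₀, hm₀⟩ := eventually_atTop.1 (hmass.and
    ((tendsto_natCast_atTop_atTop.atTop_mul_const (half_pos hε)).eventually_ge_atTop
      (M * (r + 1) - (a + ε) * r)))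
  refine eventually_atTop.2 ⟨r + m₀, fun m hm n u => ?_⟩
  obtain ⟨k, rfl⟩ := Nat.exists_eq_add_of_le ((Nat.le_add_right r m₀).trans hm)
  obtain ⟨hk1, hk2⟩ := hm₀ k (by omega)
  have hlight : ∀ w ∈ wordsOfLength ι r, ∀ v,
      f v ≤ Real.exp ((a + ε / 2) * k) → f (w ++ v) ≤ Real.exp ((a + ε) * (r + k : ℕ)) := by
    intro w hw v hv
    calc f (w ++ v) ≤ f w * f v := hf.append_le w v
      _ ≤ Real.exp (M * (r + 1)) * Real.exp ((a + ε / 2) * k) := by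
          have h1 := hfM w
          rw [mem_wordsOfLength.1 hw] at h1
          exact mul_le_mul h1 hv (hf.pos v).le (Real.exp_pos _).le
      _ ≤ _ := by
          rw [← Real.exp_add, Real.exp_le_exp]
          push_cast
          linarith
  have hu := Real.rpow_pos_of_pos (hf.pos u) t
  have hlow : κ * c * δ * f u ^ t * Real.exp ((n + k) * P t) ≤
      ∑ v ∈ wordsOfLength ι (r + k) with f v ≤ Real.exp ((a + ε) * (r + k : ℕ)),
        prefixSum f t n (u ++ v) := by
    calc κ * c * δ * f u ^ t * Real.exp ((n + k) * P t)
        = κ * Real.exp (n * P t) * c * f u ^ t * (δ * Real.exp (k * P t)) := by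
          rw [add_mul, Real.exp_add]; ring
      _ ≤ κ * Real.exp (n * P t) * c * f u ^ t *
          ∑ v ∈ wordsOfLength ι k with f v ≤ Real.exp ((a + ε / 2) * k), f v ^ t := by gcongr
      _ = ∑ v ∈ wordsOfLength ι k with f v ≤ Real.exp ((a + ε / 2) * k),
            κ * Real.exp (n * P t) * (c * (f u ^ t * f v ^ t)) := by
          rw [Finset.mul_sum]
          exact Finset.sum_congr rfl fun v _ => by ring
      _ ≤ ∑ v ∈ wordsOfLength ι k with f v ≤ Real.exp ((a + ε / 2) * k),
            ∑ w ∈ wordsOfLength ι r, prefixSum f t n (u ++ (w ++ v)) := by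
          refine Finset.sum_le_sum fun v _ => ?_
          calc _ ≤ κ * Real.exp (n * P t) *
                ∑ w ∈ wordsOfLength ι r, f (u ++ (w ++ v)) ^ t := by gcongr; exact hr u v
            _ ≤ _ := by
                rw [Finset.mul_sum]
                refine Finset.sum_le_sum fun w _ => le_trans ?_ (hT n _)
                rw [mul_assoc, mul_comm (Real.exp _)]
                have := Real.rpow_nonneg (hf.pos (u ++ (w ++ v))).le t
                gcongr
                exact hf.exp_le_partitionSum hP ht.le n
      _ ≤ _ := by
          rw [Finset.sum_comm, Finset.sum_filter, sum_wordsOfLength_add]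
          refine Finset.sum_le_sum fun w hw => ?_
          rw [Finset.sum_filter]
          refine Finset.sum_le_sum fun v _ => ?_
          have hnn : 0 ≤ prefixSum f t n (u ++ (w ++ v)) :=
            Finset.sum_nonneg fun v _ => Real.rpow_nonneg (hf.pos _).le t
          split_ifs with h1 h2 h2
          · rfl
          · exact absurd (hlight w hw v h1) h2
          · exact hnn
          · rfl
  have hup : prefixSum f t (r + k + n) u ≤
      f u ^ t * (C * Real.exp ((r + k + n : ℕ) * P t)) :=
    (hf.prefixSum_le ht.le _ u).trans (by gcongr; exact hS _)
  calc _ ≤ κ * c * δ * Real.exp (-(r * P t)) / C *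
        (f u ^ t * (C * Real.exp ((r + k + n : ℕ) * P t))) := by gcongr
    _ = κ * c * δ * f u ^ t * (Real.exp (-(r * P t)) * Real.exp ((r + k + n : ℕ) * P t)) := by
        field_simp
    _ = κ * c * δ * f u ^ t * Real.exp ((n + k) * P t) := by
        rw [← Real.exp_add]; congr 2; push_cast; ring
    _ ≤ _ := hlow

theorem eventually_heavy_prefixSum_le [Nonempty ι] (hf : IsQuasiMultiplicative f)
    (hP : IsPressure f P) {t b : ℝ} (ht : 0 < t)
    (hb : ∀ ε, 0 < ε → ∃ τ, 0 < τ ∧ P (t + τ) ≤ P t + (b + ε) * τ)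
    {ε κ : ℝ} (hε : 0 < ε) (hκ : 0 < κ) :
    ∀ᶠ m : ℕ in atTop, ∀ n u,
      ∑ v ∈ wordsOfLength ι m with ¬ f v ≤ Real.exp ((b + ε) * m), prefixSum f t n (u ++ v) ≤
        κ * prefixSum f t (m + n) u := by
  obtain ⟨κ', hκ', hT⟩ := hf.exists_le_prefixSum ht.le
  obtain ⟨C, hC, hS⟩ := hf.exists_partitionSum_le hP ht.le
  filter_upwards [hf.eventually_heavy_mass_le hP ht hb hε
    (show 0 < κ * κ' / C by positivity)] with m hm n u
  have hu := Real.rpow_pos_of_pos (hf.pos u) t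
  calc ∑ v ∈ wordsOfLength ι m with ¬ f v ≤ Real.exp ((b + ε) * m), prefixSum f t n (u ++ v)
      ≤ ∑ v ∈ wordsOfLength ι m with ¬ f v ≤ Real.exp ((b + ε) * m),
          f u ^ t * (C * Real.exp (n * P t)) * f v ^ t := by
        refine Finset.sum_le_sum fun v _ => ?_
        have hv := Real.rpow_pos_of_pos (hf.pos v) t
        calc _ ≤ f (u ++ v) ^ t * partitionSum f n t := hf.prefixSum_le ht.le n _
          _ ≤ f u ^ t * f v ^ t * (C * Real.exp (n * P t)) :=
              mul_le_mul (hf.rpow_append_le ht.le u v) (hS n) (hf.partitionSum_pos n t).le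
                (by positivity)
          _ = _ := by ring
    _ ≤ f u ^ t * (C * Real.exp (n * P t)) * (κ * κ' / C * Real.exp (m * P t)) := by
        rw [← Finset.mul_sum]; gcongr
    _ = κ * (κ' * (f u ^ t * Real.exp ((m + n : ℕ) * P t))) := by
        push_cast; rw [add_mul, Real.exp_add]; field_simp
    _ ≤ κ * prefixSum f t (m + n) u := by
        gcongr
        refine le_trans ?_ (hT _ u)
        gcongr
        exact hf.exp_le_partitionSum hP ht.le _

theorem exists_block_contraction [Nonempty ι] (hf : IsQuasiMultiplicative f)
    (hP : IsPressure f P) {t a b : ℝ} (ht : 0 < t) (hab : a < b)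
    (ha : ∀ h, 0 < h → h ≤ t → P t - a * h ≤ P (t - h))
    (hb : ∀ ε, 0 < ε → ∃ τ, 0 < τ ∧ P (t + τ) ≤ P t + (b + ε) * τ) :
    ∃ (m : ℕ) (E : ℝ), 0 < m ∧ E < Real.exp b ∧ ∀ n u,
      ∑ v ∈ wordsOfLength ι m, f v ^ (1 / m : ℝ) * prefixSum f t n (u ++ v) ≤
        E * prefixSum f t (m + n) u := by
  obtain ⟨M, hM, hfM⟩ := hf.exists_le_exp
  obtain ⟨δ, hδ, hlight⟩ := hf.exists_light_prefixSum hP ht ha (half_pos (sub_pos.2 hab))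
  set a' : ℝ := a + (b - a) / 2
  have ha'b : a' < b := by simp only [a']; linarith
  set η : ℝ := δ * (Real.exp b - Real.exp a')
  have hη : 0 < η := mul_pos hδ (sub_pos.2 (Real.exp_lt_exp.2 ha'b))
  obtain ⟨ε, hε, hεη⟩ : ∃ ε : ℝ, 0 < ε ∧ Real.exp (b + ε) ≤ Real.exp b + η / 3 := by
    have h1 : Tendsto (fun ε : ℝ => Real.exp (b + ε)) (𝓝[>] 0) (𝓝 (Real.exp (b + 0))) :=
      (Continuous.tendsto (by fun_prop) 0).mono_left nhdsWithin_le_nhds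
    rw [add_zero] at h1
    exact (eventually_mem_nhdsWithin.and
      (h1.eventually_le_const (show Real.exp b < Real.exp b + η / 3 by linarith))).exists
  have hheavy := hf.eventually_heavy_prefixSum_le hP ht hb hε
    (show 0 < η / 3 * Real.exp (-(2 * M)) by positivity)
  obtain ⟨m, hm1, hm2, hm⟩ := (hlight.and (hheavy.and (eventually_gt_atTop 0))).exists
  refine ⟨m, Real.exp b - η / 3, hm, by linarith, fun n u => ?_⟩
  have hm0 : (0 : ℝ) < m := by exact_mod_cast hm
  have hroot : ∀ v x, f v ≤ Real.exp (x * m) → f v ^ (1 / m : ℝ) ≤ Real.exp x := fun v x h => by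
    calc f v ^ (1 / m : ℝ) ≤ Real.exp (x * m) ^ (1 / m : ℝ) :=
          Real.rpow_le_rpow (hf.pos v).le h (by positivity)
      _ = Real.exp x := by rw [← Real.exp_mul]; congr 1; field_simp
  have hnn : ∀ v, 0 ≤ prefixSum f t n v := fun v =>
    Finset.sum_nonneg fun w _ => Real.rpow_nonneg (hf.pos _).le t
  have hdiff : 0 < Real.exp (b + ε) - Real.exp a' :=
    sub_pos.2 (Real.exp_lt_exp.2 (by linarith))
  have hpt : ∀ v ∈ wordsOfLength ι m, f v ^ (1 / m : ℝ) * prefixSum f t n (u ++ v) ≤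
      Real.exp (b + ε) * prefixSum f t n (u ++ v) -
      (Real.exp (b + ε) - Real.exp a') *
        (if f v ≤ Real.exp (a' * m) then prefixSum f t n (u ++ v) else 0) +
      Real.exp (2 * M) *
        (if ¬ f v ≤ Real.exp ((b + ε) * m) then prefixSum f t n (u ++ v) else 0) := by
    intro v hv
    have hv0 := hnn (u ++ v)
    by_cases h1 : f v ≤ Real.exp (a' * m)
    · have h2 := mul_le_mul_of_nonneg_right (hroot v _ h1) hv0
      have h3 : 0 ≤ Real.exp (2 * M) *
          (if ¬ f v ≤ Real.exp ((b + ε) * m) then prefixSum f t n (u ++ v) else 0) := by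
        split_ifs <;> positivity
      rw [if_pos h1]
      linarith
    · rw [if_neg h1]
      by_cases h2 : f v ≤ Real.exp ((b + ε) * m)
      · rw [if_neg (not_not.2 h2)]
        have := mul_le_mul_of_nonneg_right (hroot v _ h2) hv0
        linarith
      · rw [if_pos h2]
        have h3 : f v ≤ Real.exp (2 * M * m) := (hfM v).trans (Real.exp_le_exp.2 (by
          rw [mem_wordsOfLength.1 hv]
          have : (1 : ℝ) ≤ m := by exact_mod_cast hm
          nlinarith))
        have h4 := mul_le_mul_of_nonneg_right (hroot v _ h3) hv0
        have h5 := mul_nonneg (Real.exp_pos (b + ε)).le hv0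
        linarith
  refine (Finset.sum_le_sum hpt).trans ?_
  rw [Finset.sum_add_distrib, Finset.sum_sub_distrib, ← Finset.mul_sum, ← Finset.mul_sum,
    ← Finset.mul_sum, ← Finset.sum_filter, ← Finset.sum_filter, ← prefixSum_add]
  have hT : 0 ≤ prefixSum f t (m + n) u :=
    Finset.sum_nonneg fun w _ => Real.rpow_nonneg (hf.pos _).le t
  set T := prefixSum f t (m + n) u
  have e1 := mul_le_mul_of_nonneg_left (hm1 n u) hdiff.le
  have e2 := mul_le_mul_of_nonneg_left (hm2 n u) (Real.exp_pos (2 * M)).le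
  have e3 : Real.exp (2 * M) * (η / 3 * Real.exp (-(2 * M)) * T) = η / 3 * T := by
    rw [Real.exp_neg]; field_simp
  have e4 : η * T ≤ (Real.exp (b + ε) - Real.exp a') * (δ * T) := by
    have : Real.exp b ≤ Real.exp (b + ε) := Real.exp_le_exp.2 (by linarith)
    have h6 : η ≤ δ * (Real.exp (b + ε) - Real.exp a') := by
      simp only [η]; gcongr
    nlinarith
  have e5 := mul_le_mul_of_nonneg_right hεη hT
  linarith

theorem sum_rpow_le_of_block_contraction (hf : IsQuasiMultiplicative f) {t s E : ℝ}
    (hs : 0 ≤ s) {m : ℕ} (hE : 0 ≤ E)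
    (h : ∀ n u, ∑ v ∈ wordsOfLength ι m, f v ^ s * prefixSum f t n (u ++ v) ≤
      E * prefixSum f t (m + n) u) (k : ℕ) (u : List ι) :
    ∑ v ∈ wordsOfLength ι (k * m), f (u ++ v) ^ t * f v ^ s ≤
      f [] ^ s * E ^ k * prefixSum f t (k * m) u := by
  induction k generalizing u with
  | zero =>
    simp only [Nat.zero_mul, prefixSum, sum_wordsOfLength_zero, pow_zero, mul_one]
    rw [mul_comm]
  | succ k ih =>
    have h0 := Real.rpow_nonneg (hf.pos []).le s
    have hk : (k + 1) * m = m + k * m := by ring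
    rw [hk, sum_wordsOfLength_add]
    calc ∑ v ∈ wordsOfLength ι m, ∑ w ∈ wordsOfLength ι (k * m),
          f (u ++ (v ++ w)) ^ t * f (v ++ w) ^ s
        ≤ ∑ v ∈ wordsOfLength ι m, f v ^ s *
            ∑ w ∈ wordsOfLength ι (k * m), f (u ++ v ++ w) ^ t * f w ^ s := by
          refine Finset.sum_le_sum fun v _ => ?_
          rw [Finset.mul_sum]
          refine Finset.sum_le_sum fun w _ => ?_
          rw [mul_left_comm, List.append_assoc]
          exact mul_le_mul_of_nonneg_left (hf.rpow_append_le hs v w)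
            (Real.rpow_nonneg (hf.pos _).le t)
      _ ≤ ∑ v ∈ wordsOfLength ι m, f v ^ s *
            (f [] ^ s * E ^ k * prefixSum f t (k * m) (u ++ v)) :=
          Finset.sum_le_sum fun v _ =>
            mul_le_mul_of_nonneg_left (ih (u ++ v)) (Real.rpow_nonneg (hf.pos v).le s)
      _ = f [] ^ s * E ^ k *
            ∑ v ∈ wordsOfLength ι m, f v ^ s * prefixSum f t (k * m) (u ++ v) := by
          rw [Finset.mul_sum]
          exact Finset.sum_congr rfl fun v _ => by ring
      _ ≤ f [] ^ s * E ^ k * (E * prefixSum f t (m + k * m) u) := by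
          gcongr
          exact h _ u
      _ = _ := by ring

/-- The pressure function has no kink: lines of slopes `a` and `b` that support its graph at `t`
from the left and from the right, the latter being tangent, satisfy `b ≤ a`. -/
theorem le_of_support [Nonempty ι] (hf : IsQuasiMultiplicative f)
    (hP : IsPressure f P) {t a b : ℝ} (ht : 0 < t)
    (ha : ∀ h, 0 < h → h ≤ t → P t - a * h ≤ P (t - h))
    (hb : ∀ h, 0 < h → P t + b * h ≤ P (t + h))
    (hb' : ∀ ε, 0 < ε → ∃ τ, 0 < τ ∧ P (t + τ) ≤ P t + (b + ε) * τ) : b ≤ a := by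
  by_contra! hab
  obtain ⟨m, E, hm, hE, h⟩ := hf.exists_block_contraction hP ht hab ha hb'
  have hm0 : (0 : ℝ) < m := by exact_mod_cast hm
  obtain ⟨C, hC, hS⟩ := hf.exists_partitionSum_le hP ht.le
  have hE0 : 0 ≤ E := by
    have h1 : 0 ≤ E * prefixSum f t (m + 0) [] := (h 0 []).trans' <|
      Finset.sum_nonneg fun v _ => mul_nonneg (Real.rpow_nonneg (hf.pos v).le _)
        (Finset.sum_nonneg fun w _ => Real.rpow_nonneg (hf.pos _).le t)
    exact nonneg_of_mul_nonneg_left h1 (hf.partitionSum_pos (m + 0) t)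
  set B : ℝ := f [] ^ (1 / m : ℝ) * C
  have key : ∀ k : ℕ, 1 ≤ B * (E / Real.exp b) ^ k := fun k => by
    have h1 := hf.sum_rpow_le_of_block_contraction (by positivity) hE0 h k []
    have h2 : Real.exp ((k * m : ℕ) * P t) * Real.exp b ^ k ≤
        f [] ^ (1 / m : ℝ) * E ^ k * (C * Real.exp ((k * m : ℕ) * P t)) := by
      calc _ ≤ Real.exp ((k * m : ℕ) * P (t + 1 / m)) := by
            rw [← Real.exp_nat_mul, ← Real.exp_add, Real.exp_le_exp]
            have h3 := mul_le_mul_of_nonneg_left (hb (1 / m) (by positivity))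
              (Nat.cast_nonneg (α := ℝ) (k * m))
            refine h3.trans' (le_of_eq ?_)
            push_cast; field_simp
        _ ≤ partitionSum f (k * m) (t + 1 / m) := hf.exp_le_partitionSum hP (by positivity) _
        _ = ∑ v ∈ wordsOfLength ι (k * m), f ([] ++ v) ^ t * f v ^ (1 / m : ℝ) :=
            Finset.sum_congr rfl fun v _ => Real.rpow_add (hf.pos v) _ _
        _ ≤ _ := h1
        _ ≤ _ := by
            have := Real.rpow_nonneg (hf.pos []).le (1 / m : ℝ)
            gcongr
            exact hS _
    rw [div_pow, mul_div_assoc', le_div_iff₀ (by positivity), one_mul]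
    refine le_of_mul_le_mul_left (h2.trans_eq ?_) (Real.exp_pos ((k * m : ℕ) * P t))
    simp only [B]; ring
  have hlim : Tendsto (fun k : ℕ => B * (E / Real.exp b) ^ k) atTop (𝓝 (B * 0)) :=
    (tendsto_pow_atTop_nhds_zero_of_lt_one (by positivity)
      ((div_lt_one (Real.exp_pos b)).2 hE)).const_mul B
  have := ge_of_tendsto' hlim key
  norm_num at this

theorem convexOn_log_partitionSum [Nonempty ι] (hf : IsQuasiMultiplicative f) (n : ℕ) :
    ConvexOn ℝ univ fun t => Real.log (partitionSum f n t) := by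
  refine convexOn_iff_forall_pos.2 ⟨convex_univ, fun x _ y _ a b ha hb hab => ?_⟩
  have hx := hf.partitionSum_pos n x
  have hy := hf.partitionSum_pos n y
  simp only [smul_eq_mul]
  rw [← Real.log_rpow hx, ← Real.log_rpow hy,
    ← Real.log_mul (Real.rpow_pos_of_pos hx a).ne' (Real.rpow_pos_of_pos hy b).ne']
  refine Real.log_le_log (hf.partitionSum_pos n _) ?_
  have h := Real.inner_le_Lp_mul_Lq_of_nonneg (wordsOfLength ι n)
    (f := fun u => (f u ^ x) ^ a) (g := fun u => (f u ^ y) ^ b)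
    (Real.HolderConjugate.inv_inv ha hb hab)
    (fun u _ => by have := hf.pos u; positivity) (fun u _ => by have := hf.pos u; positivity)
  simp only [one_div, inv_inv] at h
  convert h using 1
  · refine Finset.sum_congr rfl fun u _ => ?_
    have hu := hf.pos u
    rw [Real.rpow_add hu, mul_comm a, mul_comm b, Real.rpow_mul hu.le, Real.rpow_mul hu.le]
  · congr 2 <;> refine Finset.sum_congr rfl fun u _ => ?_
    · rw [Real.rpow_rpow_inv (Real.rpow_nonneg (hf.pos u).le x) ha.ne']
    · rw [Real.rpow_rpow_inv (Real.rpow_nonneg (hf.pos u).le y) hb.ne']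

theorem convexOn_pressure [Nonempty ι] (hf : IsQuasiMultiplicative f) (hP : IsPressure f P) :
    ConvexOn ℝ univ P := by
  refine ⟨convex_univ, fun x _ y _ a b ha hb hab => ?_⟩
  refine le_of_tendsto_of_tendsto' (hP _) (((hP x).const_mul a).add ((hP y).const_mul b))
    fun n => ?_
  have h := (hf.convexOn_log_partitionSum n).2 (mem_univ x) (mem_univ y) ha hb hab
  simp only [smul_eq_mul] at h
  calc _ ≤ (a * Real.log (partitionSum f n x) + b * Real.log (partitionSum f n y)) / n := by
        gcongr; exact h
    _ = _ := by ring

theorem differentiableAt_pressure [Nonempty ι] (hf : IsQuasiMultiplicative f)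
    (hP : IsPressure f P) {t : ℝ} (ht : 0 < t) : DifferentiableAt ℝ P t := by
  have hconv := hf.convexOn_pressure hP
  have hint : t ∈ interior (univ : Set ℝ) := by simp
  have hL := hconv.hasDerivWithinAt_leftDeriv_of_mem_interior hint
  have hR := hconv.hasDerivWithinAt_rightDeriv_of_mem_interior hint
  have hle := hconv.leftDeriv_le_rightDeriv_of_mem_interior hint
  set a := derivWithin P (Iio t) t
  set b := derivWithin P (Ioi t) t
  have hba : b ≤ a := by
    refine hf.le_of_support hP ht (fun h h0 _ => ?_) (fun h h0 => ?_) (fun ε hε => ?_)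
    · have := hconv.slope_le_of_hasDerivWithinAt_Iio (mem_univ (t - h)) (mem_univ t)
        (by linarith) hL
      rw [slope_def_field, div_le_iff₀ (by linarith)] at this
      linarith
    · have := hconv.le_slope_of_hasDerivWithinAt_Ioi (mem_univ t) (mem_univ (t + h))
        (by linarith) hR
      rw [slope_def_field, le_div_iff₀ (by linarith)] at this
      linarith
    · have h1 := (hasDerivWithinAt_iff_tendsto_slope' self_notMem_Ioi).1 hR
      obtain ⟨y, hy, hty⟩ := ((h1.eventually_le_const (show b < b + ε by linarith)).and
        self_mem_nhdsWithin).exists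
      have hty' : t < y := hty
      rw [slope_def_field, div_le_iff₀ (by linarith)] at hy
      refine ⟨y - t, by linarith, ?_⟩
      rw [add_sub_cancel]
      linarith
  rw [le_antisymm hle hba] at hL
  exact (hL.Iic_of_Iio.union hR.Ici_of_Ioi).differentiableWithinAt.differentiableAt (by simp)

theorem hasDerivAt_log_partitionSum [Nonempty ι] (hf : IsQuasiMultiplicative f) (n : ℕ) :
    HasDerivAt (fun t => Real.log (partitionSum f n t))
      (∑ u ∈ wordsOfLength ι n, ((Fintype.card ι : ℝ) ^ n)⁻¹ * Real.log (f u)) 0 := by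
  have h : HasDerivAt (fun t => partitionSum f n t)
      (∑ u ∈ wordsOfLength ι n, f u ^ (0 : ℝ) * Real.log (f u)) 0 := by
    simp only [partitionSum]
    exact HasDerivAt.fun_sum fun u _ => (Real.hasStrictDerivAt_const_rpow (hf.pos u) 0).hasDerivAt
  refine (h.log (hf.partitionSum_pos n 0).ne').congr_deriv ?_
  rw [div_eq_inv_mul, Finset.mul_sum]
  simp [partitionSum, card_wordsOfLength]

theorem pressure_zero [Nonempty ι] (hP : IsPressure f P) : P 0 = Real.log (Fintype.card ι) := by
  refine tendsto_nhds_unique (hP 0) (tendsto_const_nhds.congr' ?_)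
  filter_upwards [eventually_gt_atTop 0] with n hn
  have : (n : ℝ) ≠ 0 := by exact_mod_cast hn.ne'
  simp only [partitionSum, Real.rpow_zero, Finset.sum_const, card_wordsOfLength, nsmul_eq_mul,
    mul_one, Nat.cast_pow, Real.log_pow]
  field_simp

theorem tendsto_deriv_pressure [Nonempty ι] (hf : IsQuasiMultiplicative f)
    (hP : IsPressure f P) {β : ℝ}
    (hβ : Tendsto (fun n : ℕ => (∑ u ∈ wordsOfLength ι n,
      ((Fintype.card ι : ℝ) ^ n)⁻¹ * Real.log (f u)) / n) atTop (𝓝 β)) :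
    Tendsto (deriv P) (𝓝[>] 0) (𝓝 β) := by
  have hconv := hf.convexOn_pressure hP
  have hlog0 : ∀ n : ℕ, Real.log (partitionSum f n 0) = n * P 0 := fun n => by
    rw [pressure_zero hP]
    simp [partitionSum, card_wordsOfLength, Real.log_pow]
  have hlow : ∀ t, 0 < t → P 0 + t * β ≤ P t := fun t ht => by
    refine le_of_tendsto_of_tendsto ((tendsto_const_nhds (x := P 0)).add (hβ.const_mul t)) (hP t) ?_
    filter_upwards [eventually_gt_atTop 0] with n hn
    have hn0 : (0 : ℝ) < n := by exact_mod_cast hn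
    have h := (hf.convexOn_log_partitionSum n).le_slope_of_hasDerivAt (mem_univ 0) (mem_univ t) ht
      (hf.hasDerivAt_log_partitionSum n)
    rw [slope_def_field, sub_zero, le_div_iff₀ ht, hlog0] at h
    rw [le_div_iff₀ hn0, add_mul, mul_assoc t, div_mul_cancel₀ _ hn0.ne']
    linarith
  have hslope : Tendsto (slope P 0) (𝓝[>] 0) (𝓝 β) := by
    refine tendsto_order.2 ⟨fun x hx => ?_, fun x hx => ?_⟩
    · filter_upwards [self_mem_nhdsWithin] with t ht
      have ht' : 0 < t := ht
      refine hx.trans_le ?_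
      rw [slope_def_field, sub_zero, le_div_iff₀ ht']
      linarith [hlow t ht']
    · obtain ⟨n, hnx, hn⟩ := ((hβ.eventually_lt_const hx).and (eventually_gt_atTop 0)).exists
      have hn0 : (0 : ℝ) < n := by exact_mod_cast hn
      rw [div_lt_iff₀ hn0] at hnx
      have h1 := ((hasDerivWithinAt_iff_tendsto_slope' self_notMem_Ioi).1
        (hf.hasDerivAt_log_partitionSum n).hasDerivWithinAt).eventually_lt_const hnx
      filter_upwards [h1, self_mem_nhdsWithin] with t h2 ht
      have ht' : 0 < t := ht
      rw [slope_def_field, sub_zero, div_lt_iff₀ ht', hlog0] at h2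
      rw [slope_def_field, sub_zero, div_lt_iff₀ ht']
      have h3 := (Real.le_log_iff_exp_le (hf.partitionSum_pos n t)).2
        (hf.exp_le_partitionSum hP ht'.le n)
      have h4 : n * (P t - P 0) < n * (x * t) := by linarith
      exact lt_of_mul_lt_mul_left h4 hn0.le
  have hdbl : Tendsto (fun t : ℝ => 2 * t) (𝓝[>] 0) (𝓝[>] 0) := by
    refine tendsto_nhdsWithin_iff.2 ⟨?_, ?_⟩
    · have : Tendsto (fun t : ℝ => 2 * t) (𝓝 0) (𝓝 (2 * 0)) := Continuous.tendsto (by fun_prop) 0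
      rw [mul_zero] at this
      exact this.mono_left nhdsWithin_le_nhds
    · filter_upwards [self_mem_nhdsWithin] with t ht
      have ht' : 0 < t := ht
      exact mul_pos two_pos ht'
  have hupper : Tendsto (fun t => 2 * slope P 0 (2 * t) - slope P 0 t) (𝓝[>] 0) (𝓝 β) := by
    have := ((hslope.comp hdbl).const_mul 2).sub hslope
    rwa [two_mul β, add_sub_cancel_right] at this
  refine tendsto_of_tendsto_of_tendsto_of_le_of_le' hslope hupper ?_ ?_
  · filter_upwards [self_mem_nhdsWithin] with t ht
    exact hconv.slope_le_deriv (mem_univ 0) (mem_univ t) ht (hf.differentiableAt_pressure hP ht)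
  · filter_upwards [self_mem_nhdsWithin] with t ht
    have ht' : 0 < t := ht
    refine (hconv.deriv_le_slope (mem_univ t) (mem_univ (2 * t)) (by linarith)
      (hf.differentiableAt_pressure hP ht)).trans_eq ?_
    simp only [slope_def_field, sub_zero]
    field_simp
    ring

end IsQuasiMultiplicative

end Pressure

section EntrySum

variable {κ : Type*} [Fintype κ]

/-- The sum of the entries of a matrix. -/
def entrySum (A : Matrix κ κ ℝ) : ℝ := ∑ i, ∑ j, A i j

theorem entrySum_mul (A B : Matrix κ κ ℝ) :
    entrySum (A * B) = ∑ k, (∑ i, A i k) * ∑ j, B k j := by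
  simp only [entrySum, Matrix.mul_apply, Finset.sum_mul_sum]
  rw [Finset.sum_congr rfl fun i _ => Finset.sum_comm, Finset.sum_comm]

theorem entrySum_mul_le {A B : Matrix κ κ ℝ} (hA : ∀ i j, 0 ≤ A i j) (hB : ∀ i j, 0 ≤ B i j) :
    entrySum (A * B) ≤ entrySum A * entrySum B := by
  have hcol : entrySum A = ∑ k, ∑ i, A i k := Finset.sum_comm
  rw [entrySum_mul, hcol, Finset.sum_mul]
  refine Finset.sum_le_sum fun k _ =>
    mul_le_mul_of_nonneg_left ?_ (Finset.sum_nonneg fun i _ => hA i k)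
  exact Finset.single_le_sum (f := fun k => ∑ j, B k j)
    (fun k _ => Finset.sum_nonneg fun j _ => hB k j) (Finset.mem_univ k)

theorem colSum_mul_le_entrySum {A B : Matrix κ κ ℝ} (hA : ∀ i j, 0 ≤ A i j)
    (hB : ∀ i j, 0 ≤ B i j) (k : κ) : (∑ i, A i k) * ∑ j, B k j ≤ entrySum (A * B) := by
  rw [entrySum_mul]
  exact Finset.single_le_sum (f := fun k => (∑ i, A i k) * ∑ j, B k j)
    (fun k _ => mul_nonneg (Finset.sum_nonneg fun i _ => hA i k)
      (Finset.sum_nonneg fun j _ => hB k j)) (Finset.mem_univ k)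

theorem rowSum_mul (A B : Matrix κ κ ℝ) (i : κ) :
    ∑ j, (A * B) i j = ∑ k, A i k * ∑ j, B k j := by
  simp only [Matrix.mul_apply, Finset.mul_sum]
  exact Finset.sum_comm

theorem exists_sum_le_card_mul [Nonempty κ] (g : κ → ℝ) :
    ∃ k, ∑ i, g i ≤ Fintype.card κ * g k := by
  obtain ⟨k, hk⟩ := Finite.exists_max g
  exact ⟨k, (Finset.sum_le_sum fun i _ => hk i).trans_eq (by simp)⟩

end EntrySum

section Gasket

variable {p q : ℕ}

/-- The weight of a word: the sum of the entries of the associated product of the matrices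
`gmA p q 0` and `gmA p q 1`. -/
def gmWeight (p q : ℕ) (u : List (Fin 2)) : ℝ :=
  entrySum (u.map fun d : Fin 2 => gmA p q d).prod

theorem gmWeight_ofFn {n : ℕ} (ξ : Fin n → Fin 2) : gmWeight p q (List.ofFn ξ) = eAe p q ξ := by
  rw [gmWeight, List.map_ofFn]
  rfl

theorem gmA_nonneg (n : ℕ) (i j : Fin (p + q)) : 0 ≤ gmA p q n i j := by
  rw [gmA, Matrix.of_apply]
  split_ifs <;> norm_num

theorem gmA_eq_one {n : ℕ} {i j : Fin (p + q)}
    (h : 2 * ((i : ℤ) + 1) + 1 - (n : ℤ) ≡ (j : ℤ) + 1 [ZMOD (p : ℤ) + q]) :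
    gmA p q n i j = 1 := by
  rw [gmA, Matrix.of_apply, if_pos (Or.inl h)]

theorem exists_fin_modEq (hp : 0 < p) (z : ℤ) :
    ∃ j : Fin (p + q), z ≡ (j : ℤ) + 1 [ZMOD (p : ℤ) + q] := by
  have hN : (0 : ℤ) < (p : ℤ) + q := by positivity
  have h0 := Int.emod_nonneg (z - 1) hN.ne'
  have h1 := Int.emod_lt_of_pos (z - 1) hN
  refine ⟨⟨((z - 1) % ((p : ℤ) + q)).toNat, by omega⟩, ?_⟩
  simp only [Int.toNat_of_nonneg h0]
  simpa using ((Int.mod_modEq (z - 1) ((p : ℤ) + q)).add_right 1).symm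

theorem fin_eq_of_modEq {i j : Fin (p + q)}
    (h : (i : ℤ) + 1 ≡ (j : ℤ) + 1 [ZMOD (p : ℤ) + q]) : i = j := by
  have h1 := Int.ModEq.add_right_cancel' 1 h
  rw [Int.ModEq, Int.emod_eq_of_lt (by positivity) (by exact_mod_cast i.2),
    Int.emod_eq_of_lt (by positivity) (by exact_mod_cast j.2)] at h1
  exact Fin.ext (by exact_mod_cast h1)

theorem list_prod_gmA_nonneg (u : List (Fin 2)) (i j : Fin (p + q)) :
    0 ≤ (u.map fun d : Fin 2 => gmA p q d).prod i j := by
  induction u generalizing i with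
  | nil =>
    rw [List.map_nil, List.prod_nil, Matrix.one_apply]
    split_ifs <;> norm_num
  | cons d u ih =>
    rw [List.map_cons, List.prod_cons, Matrix.mul_apply]
    exact Finset.sum_nonneg fun k _ => mul_nonneg (gmA_nonneg _ _ _) (ih k)

theorem one_le_rowSum_list_prod_gmA (hp : 0 < p) (u : List (Fin 2)) (i : Fin (p + q)) :
    1 ≤ ∑ j, (u.map fun d : Fin 2 => gmA p q d).prod i j := by
  induction u generalizing i with
  | nil => simp [Matrix.one_apply]
  | cons d u ih =>
    rw [List.map_cons, List.prod_cons, rowSum_mul]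
    obtain ⟨k, hk⟩ := exists_fin_modEq (q := q) hp (2 * ((i : ℤ) + 1) + 1 - ((d : ℕ) : ℤ))
    have h1 := Finset.single_le_sum (f := fun k => gmA p q d i k *
      ∑ j, (u.map fun d : Fin 2 => gmA p q d).prod k j)
      (fun k _ => mul_nonneg (gmA_nonneg _ _ _) (zero_le_one.trans (ih k))) (Finset.mem_univ k)
    simp only [gmA_eq_one hk, one_mul] at h1
    exact (ih k).trans h1

theorem exists_one_le_list_prod_gmA_of_modEq (hp : 0 < p) (r : ℕ) (i j : Fin (p + q)) (k : ℕ)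
    (hk : k < 2 ^ r) (h : 2 ^ r * ((i : ℤ) + 1) + k ≡ (j : ℤ) + 1 [ZMOD (p : ℤ) + q]) :
    ∃ w ∈ wordsOfLength (Fin 2) r, 1 ≤ (w.map fun d : Fin 2 => gmA p q d).prod i j := by
  induction r generalizing i k with
  | zero =>
    obtain rfl : k = 0 := by simpa using hk
    obtain rfl : i = j := fin_eq_of_modEq (by simpa using h)
    exact ⟨[], by simp [mem_wordsOfLength], by simp⟩
  | succ r ih =>
    obtain ⟨d, k', hk', hkd⟩ : ∃ (d : Fin 2) (k' : ℕ), k' < 2 ^ r ∧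
        (k : ℤ) = 2 ^ r * (1 - ((d : ℕ) : ℤ)) + k' := by
      rw [pow_succ] at hk
      by_cases hkr : k < 2 ^ r
      · exact ⟨1, k, hkr, by simp⟩
      · refine ⟨0, k - 2 ^ r, by omega, ?_⟩
        rw [Nat.cast_sub (not_lt.1 hkr)]
        simp
    obtain ⟨l, hl⟩ := exists_fin_modEq (q := q) hp (2 * ((i : ℤ) + 1) + 1 - ((d : ℕ) : ℤ))
    obtain ⟨w, hw, hwl⟩ := ih l k' hk' (by
      refine ((hl.mul_left (2 ^ r)).add_right k').symm.trans ?_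
      convert h using 1
      rw [hkd]
      ring)
    refine ⟨d :: w, ?_, ?_⟩
    · rw [mem_wordsOfLength] at hw ⊢
      simp [hw]
    · rw [List.map_cons, List.prod_cons, Matrix.mul_apply]
      have h1 := Finset.single_le_sum (f := fun l => gmA p q d i l *
        (w.map fun d : Fin 2 => gmA p q d).prod l j)
        (fun l _ => mul_nonneg (gmA_nonneg _ _ _) (list_prod_gmA_nonneg _ _ _))
        (Finset.mem_univ l)
      simp only [gmA_eq_one hl, one_mul] at h1
      exact hwl.trans h1

theorem exists_one_le_list_prod_gmA (hp : 0 < p) (i j : Fin (p + q)) :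
    ∃ w ∈ wordsOfLength (Fin 2) (p + q),
      1 ≤ (w.map fun d : Fin 2 => gmA p q d).prod i j := by
  have hN : (0 : ℤ) < (p : ℤ) + q := by positivity
  set z : ℤ := (j : ℤ) + 1 - 2 ^ (p + q) * ((i : ℤ) + 1)
  have h0 := Int.emod_nonneg z hN.ne'
  have h1 := Int.emod_lt_of_pos z hN
  have h2 := Nat.lt_two_pow_self (n := p + q)
  refine exists_one_le_list_prod_gmA_of_modEq hp (p + q) i j (z % ((p : ℤ) + q)).toNat
    (by omega) ?_
  rw [Int.toNat_of_nonneg h0]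
  refine ((Int.mod_modEq z ((p : ℤ) + q)).add_left _).trans ?_
  simp only [z, add_sub_cancel]
  exact Int.ModEq.rfl

theorem isQuasiMultiplicative_gmWeight (hp : 0 < p) :
    IsQuasiMultiplicative (gmWeight p q) where
  one_le u := by
    have h := Finset.single_le_sum
      (f := fun i => ∑ j, (u.map fun d : Fin 2 => gmA p q d).prod i j)
      (fun i _ => zero_le_one.trans (one_le_rowSum_list_prod_gmA hp u i))
      (Finset.mem_univ (⟨0, by omega⟩ : Fin (p + q)))
    exact (one_le_rowSum_list_prod_gmA hp u _).trans h
  append_le u v := by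
    rw [gmWeight, List.map_append, List.prod_append]
    exact entrySum_mul_le (list_prod_gmA_nonneg u) (list_prod_gmA_nonneg v)
  exists_le_append := by
    have : Nonempty (Fin (p + q)) := ⟨⟨0, by omega⟩⟩
    refine ⟨p + q, ((p + q : ℕ) ^ 2 : ℝ)⁻¹, by positivity, fun u v => ?_⟩
    set U := (u.map fun d : Fin 2 => gmA p q d).prod
    set V := (v.map fun d : Fin 2 => gmA p q d).prod
    obtain ⟨k, hk⟩ := exists_sum_le_card_mul fun k => ∑ i, U i k
    obtain ⟨l, hl⟩ := exists_sum_le_card_mul fun l => ∑ j, V l j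
    rw [Fintype.card_fin] at hk hl
    obtain ⟨w, hw, hkl⟩ := exists_one_le_list_prod_gmA hp k l
    refine ⟨w, hw, ?_⟩
    set W := (w.map fun d : Fin 2 => gmA p q d).prod
    have hU0 : ∀ i j, 0 ≤ U i j := list_prod_gmA_nonneg u
    have hV0 : ∀ i j, 0 ≤ V i j := list_prod_gmA_nonneg v
    have hW0 : ∀ i j, 0 ≤ W i j := list_prod_gmA_nonneg w
    have hcol : 0 ≤ ∑ i, U i k := Finset.sum_nonneg fun i _ => hU0 i k
    have hrow : ∀ l, 0 ≤ ∑ j, V l j := fun l => Finset.sum_nonneg fun j _ => hV0 l j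
    have hWV : ∑ j, V l j ≤ ∑ j, (W * V) k j := by
      rw [rowSum_mul]
      refine (le_mul_of_one_le_left (hrow l) hkl).trans ?_
      exact Finset.single_le_sum (f := fun l => W k l * ∑ j, V l j)
        (fun l _ => mul_nonneg (hW0 k l) (hrow l)) (Finset.mem_univ l)
    have hUWV : (∑ i, U i k) * ∑ j, (W * V) k j ≤ entrySum (U * (W * V)) := by
      refine colSum_mul_le_entrySum hU0 (fun i j => ?_) k
      rw [Matrix.mul_apply]
      exact Finset.sum_nonneg fun l _ => mul_nonneg (hW0 i l) (hV0 l j)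
    have hu : gmWeight p q u ≤ (p + q : ℕ) * ∑ i, U i k := by
      exact (Finset.sum_comm (f := fun i k => U i k)).trans_le hk
    have hv : gmWeight p q v ≤ (p + q : ℕ) * ∑ j, V l j := hl
    have huvw : gmWeight p q (u ++ (w ++ v)) = entrySum (U * (W * V)) := by
      rw [gmWeight, List.map_append, List.map_append, List.prod_append, List.prod_append]
    have hv0 : 0 ≤ gmWeight p q v := by
      rw [gmWeight, entrySum]
      exact Finset.sum_nonneg fun l _ => hrow l
    rw [huvw, inv_mul_le_iff₀ (by positivity)]
    calc gmWeight p q u * gmWeight p q v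
        ≤ ((p + q : ℕ) * ∑ i, U i k) * ((p + q : ℕ) * ∑ j, V l j) :=
          mul_le_mul hu hv hv0 (by positivity)
      _ = ((p + q : ℕ) ^ 2 : ℝ) * ((∑ i, U i k) * ∑ j, V l j) := by ring
      _ ≤ ((p + q : ℕ) ^ 2 : ℝ) * entrySum (U * (W * V)) := by
          gcongr
          exact (mul_le_mul_of_nonneg_left hWV hcol).trans hUWV

end Gasket

/-- **Lemma.** For coprime positive integers `p, q`, the pressure function `P` is
differentiable on `(0, ∞)` and `lim_{t→0+} P'(t) = α(θ) log 2`, where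
`α(θ) = (1/log 2) lim (1/n) Σ_ξ 2⁻ⁿ log (e A_{ξ_1} ⋯ A_{ξ_n} e)`. -/
theorem gmA_pressure_deriv_limit_at_zero
    (p q : ℕ) (hp : 0 < p) (hq : 0 < q) (hpq : Nat.Coprime p q)
    (Pfn : ℝ → ℝ)
    (hPfn : ∀ t : ℝ, Tendsto (fun n : ℕ =>
        Real.log (∑ ξ : Fin n → Fin 2, eAe p q ξ ^ t) / n) atTop (𝓝 (Pfn t)))
    (α : ℝ)
    (hα : Tendsto (fun n : ℕ =>
        (∑ ξ : Fin n → Fin 2, ((2 : ℝ) ^ n)⁻¹ * Real.log (eAe p q ξ)) / (n * Real.log 2))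
      atTop (𝓝 α)) :
    (∀ t : ℝ, 0 < t → DifferentiableAt ℝ Pfn t) ∧
      Tendsto (deriv Pfn) (𝓝[>] (0 : ℝ)) (𝓝 (α * Real.log 2)) := by
  have hf := isQuasiMultiplicative_gmWeight (q := q) hp
  have hP : IsPressure (gmWeight p q) Pfn := by
    simpa only [IsPressure, partitionSum, sum_wordsOfLength, gmWeight_ofFn] using hPfn
  refine ⟨fun t ht => hf.differentiableAt_pressure hP ht, hf.tendsto_deriv_pressure hP ?_⟩
  simp only [sum_wordsOfLength, gmWeight_ofFn, Fintype.card_fin, Nat.cast_ofNat]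
  refine (hα.mul_const (Real.log 2)).congr fun n => ?_
  have h2 : Real.log 2 ≠ 0 := (Real.log_pos one_lt_two).ne'
  rw [← div_div, div_mul_cancel₀ _ h2]

end
end
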